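/- For every real number x with |x| < 1/2, the exponential generating function identity Σ_{n=0}^{∞} ζ̄_n x^n / n! = Γ(1−2x) / Γ(1−x)² holds, where ζ̄_0 = 1 and ζ̄_n = ζ̄_n(1,…,1) for n ≥ 1. -/

import Mathlib

open scoped Nat

/-- The symmetrized Mordell–Tornheim zeta function `ζ̄_n(w₁,…,wₙ)`. -/
noncomputable def symMT (n : ℕ) (w : Fin n → ℕ) : ℝ :=
  ∑' a : {a : Fin n → ℤ // (∀ i, a i ≠ 0) ∧ ∑ i, a i = 0},
    1 / |∏ i, ((a.1 i : ℝ)) ^ w i|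

open Filter Topology

noncomputable def gP (x : ℝ) (k : ℕ) : ℝ := ∏ j ∈ Finset.range k, (x + j)

noncomputable def gE (x : ℝ) (k : ℕ) : ℝ := gP x k / k !

noncomputable def gT (x : ℝ) (N k : ℕ) : ℝ := gP x k ^ 2 / (k ! * gP ((N : ℝ) + 1) k)

lemma gP_succ (x : ℝ) (k : ℕ) : gP x (k+1) = gP x k * (x + k) := by
  simp [gP, Finset.prod_range_succ]

lemma gP_one (k : ℕ) : gP 1 k = k ! := by
  induction k with
  | zero => simp [gP]
  | succ k ih => rw [gP_succ, ih, Nat.factorial_succ]; push_cast; ring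

lemma gP_pos {x : ℝ} (hx : 0 < x) (k : ℕ) : 0 < gP x k :=
  Finset.prod_pos fun j _ => by positivity

lemma gP_abs_le {x y : ℝ} (hxy : |x| ≤ y) (k : ℕ) : |gP x k| ≤ gP y k := by
  unfold gP
  rw [Finset.abs_prod]
  refine Finset.prod_le_prod (fun _ _ => abs_nonneg _) fun j _ => ?_
  calc |x + j| ≤ |x| + |(j:ℝ)| := abs_add_le _ _
    _ ≤ y + j := by rw [Nat.abs_cast]; linarith

lemma gE_succ (x : ℝ) (k : ℕ) : (k + 1) * gE x (k+1) = (k + x) * gE x k := by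
  unfold gE
  rw [gP_succ, Nat.factorial_succ]
  have : (k ! : ℝ) ≠ 0 := by positivity
  push_cast
  field_simp
  ring

lemma gE_abs_le {x y : ℝ} (hxy : |x| ≤ y) (k : ℕ) : |gE x k| ≤ gE y k := by
  unfold gE
  rw [abs_div, Nat.abs_cast]
  gcongr
  exact gP_abs_le hxy k

lemma gP_gammaSeq {s : ℝ} (hs : 0 < s) (n : ℕ) (hn : 0 < n) :
    gP s (n+1) = (n:ℝ)^s * n ! / Real.GammaSeq s n := by
  have h := gP_pos hs (n+1)
  have h2 : (0:ℝ) < (n:ℝ)^s := by positivity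
  have : (n ! : ℝ) ≠ 0 := by positivity
  unfold Real.GammaSeq
  change _ = _ / (_ / gP s (n+1))
  field_simp

lemma gE_sq_eq {y : ℝ} (hy : 0 < y) (n : ℕ) (hn : 0 < n) :
    gE y (n+1) ^ 2 = (n:ℝ)^(2*y) / (((n:ℝ)+1)^2) * (1 / (Real.GammaSeq y n)^2) := by
  unfold gE
  rw [gP_gammaSeq hy n hn, Nat.factorial_succ]
  have : (n ! : ℝ) ≠ 0 := by positivity
  have h3 : (n:ℝ)^(2*y) = ((n:ℝ)^y)^2 := by
    rw [mul_comm, Real.rpow_mul (by positivity)]; norm_cast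
  rw [h3]
  push_cast
  field_simp

lemma inv_gammaSeq_tendsto {y : ℝ} (hy : 0 < y) :
    Tendsto (fun n => 1 / (Real.GammaSeq y n)^2) atTop (𝓝 (1 / (Real.Gamma y)^2)) := by
  refine Tendsto.div tendsto_const_nhds ((Real.GammaSeq_tendsto_Gamma y).pow 2) ?_
  have := Real.Gamma_pos_of_pos hy
  positivity

lemma summable_gE_sq_pos {y : ℝ} (hy : 0 < y) (hy2 : y < 1/2) :
    Summable (fun k => gE y k ^ 2) := by
  rw [← summable_nat_add_iff 1]
  refine summable_of_isBigO_nat (g := fun n : ℕ => (n:ℝ)^(2*y-2)) ?_ ?_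
  · exact Real.summable_nat_rpow.2 (by linarith)
  · have h1 : (fun n : ℕ => (n:ℝ)^(2*y) / (((n:ℝ)+1)^2) * (1 / (Real.GammaSeq y n)^2)) =O[atTop]
      (fun n : ℕ => (n:ℝ)^(2*y-2) * 1) := by
      refine Asymptotics.IsBigO.mul ?_ ((inv_gammaSeq_tendsto hy).isBigO_one ℝ)
      refine Asymptotics.IsBigO.of_bound 1 ?_
      filter_upwards [eventually_gt_atTop 0] with n hn
      have hn' : (0:ℝ) < n := by exact_mod_cast hn
      rw [Real.norm_of_nonneg (by positivity), Real.norm_of_nonneg (by positivity), one_mul,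
        Real.rpow_sub hn']
      norm_cast
      gcongr
      simp
    simp only [mul_one] at h1
    refine h1.congr' ?_ EventuallyEq.rfl
    filter_upwards [eventually_gt_atTop 0] with n hn
    rw [gE_sq_eq hy n hn]

lemma tendsto_gE_sq_pos {y : ℝ} (hy : 0 < y) (hy2 : y < 1/2) :
    Tendsto (fun k : ℕ => k * gE y k ^ 2) atTop (𝓝 0) := by
  rw [← tendsto_add_atTop_iff_nat 1]
  have h1 : Tendsto (fun n : ℕ => (n:ℝ)^(2*y-1) * (1 / (Real.GammaSeq y n)^2)) atTop
      (𝓝 (0 * (1 / (Real.Gamma y)^2))) := by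
    refine Tendsto.mul ?_ (inv_gammaSeq_tendsto hy)
    have := (tendsto_rpow_neg_atTop (y := 1 - 2*y) (by linarith)).comp
      (tendsto_natCast_atTop_atTop (R := ℝ))
    refine this.congr fun n => ?_
    simp
  rw [zero_mul] at h1
  refine squeeze_zero' (Eventually.of_forall fun n => by positivity) ?_ h1
  filter_upwards [eventually_gt_atTop 0] with n hn
  have hn' : (0:ℝ) < n := by exact_mod_cast hn
  rw [gE_sq_eq hy n hn, ← mul_assoc]
  gcongr
  rw [Real.rpow_sub hn', Real.rpow_one]
  push_cast
  have : ((n:ℝ)+1) * ((n:ℝ) ^ (2*y) / ((n:ℝ)+1)^2) = (n:ℝ) ^ (2*y) / ((n:ℝ)+1) := by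
    field_simp
  rw [this]
  gcongr
  simp

lemma exists_bd {x : ℝ} (hx : |x| < 1/2) : ∃ y, 0 < y ∧ y < 1/2 ∧ |x| ≤ y :=
  ⟨(|x| + 1/2)/2, by positivity, by linarith, by linarith⟩

lemma gE_sq_le {x y : ℝ} (hxy : |x| ≤ y) (k : ℕ) : gE x k ^ 2 ≤ gE y k ^ 2 := by
  rw [← sq_abs (gE x k)]
  gcongr
  exact gE_abs_le hxy k

lemma summable_gE_sq {x : ℝ} (hx : |x| < 1/2) : Summable (fun k => gE x k ^ 2) := by
  obtain ⟨y, h1, h2, h3⟩ := exists_bd hx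
  exact Summable.of_nonneg_of_le (fun _ => sq_nonneg _) (gE_sq_le h3) (summable_gE_sq_pos h1 h2)

lemma tendsto_gE_sq {x : ℝ} (hx : |x| < 1/2) :
    Tendsto (fun k : ℕ => k * gE x k ^ 2) atTop (𝓝 0) := by
  obtain ⟨y, h1, h2, h3⟩ := exists_bd hx
  refine squeeze_zero (fun _ => by positivity) (fun k => ?_) (tendsto_gE_sq_pos h1 h2)
  have := gE_sq_le h3 k
  gcongr

lemma gT_nonneg (x : ℝ) (N k : ℕ) : 0 ≤ gT x N k := by
  have := gP_pos (x := (N:ℝ)+1) (by positivity) k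
  unfold gT; positivity

lemma gT_zero (x : ℝ) (k : ℕ) : gT x 0 k = gE x k ^ 2 := by
  unfold gT gE
  simp [gP_one, sq, div_mul_div_comm]

lemma gT_le (x : ℝ) (N k : ℕ) : gT x N k ≤ gE x k ^ 2 := by
  rw [← gT_zero]
  unfold gT
  have := gP_pos (x := ((0:ℕ):ℝ)+1) (by positivity) k
  have h2 : gP (((0:ℕ):ℝ)+1) k ≤ gP ((N:ℝ)+1) k :=
    (le_abs_self _).trans (gP_abs_le (by rw [abs_of_nonneg (by positivity)]; simp) k)
  gcongr

lemma gP_shift (c : ℝ) (k : ℕ) : gP (c+1) k * c = gP c k * (c + k) := by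
  induction k with
  | zero => simp [gP]
  | succ k ih => rw [gP_succ, gP_succ, mul_right_comm, ih]; push_cast; ring

lemma gT_cert (x : ℝ) (N k : ℕ) :
    ((N:ℝ) + 1 - 2 * x) * gT x N k - ((N:ℝ)+1-x)^2/((N:ℝ)+1) * gT x (N+1) k
      = k * gT x N k - ((k+1 : ℕ):ℝ) * gT x N (k+1) := by
  unfold gT
  set c : ℝ := (N:ℝ)+1 with hc
  have hc0 : 0 < c := by positivity
  have h1 := gP_pos hc0 k
  have h2 : gP (((N+1:ℕ):ℝ)+1) k = gP c k * (c+k) / c := by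
    rw [← gP_shift]; push_cast; rw [← hc]; field_simp
  rw [h2, gP_succ, gP_succ, Nat.factorial_succ]
  have : (k ! : ℝ) ≠ 0 := by positivity
  have : c + k ≠ 0 := by positivity
  push_cast
  field_simp
  ring

lemma summable_gT {x : ℝ} (hx : |x| < 1/2) (N : ℕ) : Summable (gT x N) :=
  Summable.of_nonneg_of_le (gT_nonneg x N) (gT_le x N) (summable_gE_sq hx)

lemma gF_rec {x : ℝ} (hx : |x| < 1/2) (N : ℕ) :
    ((N:ℝ) + 1 - 2 * x) * ∑' k, gT x N k = ((N:ℝ)+1-x)^2/((N:ℝ)+1) * ∑' k, gT x (N+1) k := by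
  have h1 := ((summable_gT hx N).hasSum.mul_left ((N:ℝ) + 1 - 2 * x)).sub
    ((summable_gT hx (N+1)).hasSum.mul_left (((N:ℝ)+1-x)^2/((N:ℝ)+1)))
  have h2 := h1.tendsto_sum_nat
  have h3 : Tendsto (fun k : ℕ => k * gT x N k) atTop (𝓝 0) := by
    refine squeeze_zero (fun k => mul_nonneg (by positivity) (gT_nonneg _ _ _)) (fun k => ?_) (tendsto_gE_sq hx)
    have := gT_le x N k
    gcongr
  have h4 : ∀ n : ℕ, ∑ k ∈ Finset.range n, (((N:ℝ) + 1 - 2 * x) * gT x N k - ((N:ℝ)+1-x)^2/((N:ℝ)+1) * gT x (N+1) k) = - (n * gT x N n) := by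
    intro n
    rw [Finset.sum_congr rfl fun k _ => gT_cert x N k,
      Finset.sum_range_sub' (fun k : ℕ => (k:ℝ) * gT x N k)]
    simp
  simp only [h4] at h2
  have := tendsto_nhds_unique h2 h3.neg
  linarith

lemma gF_prod {x : ℝ} (hx : |x| < 1/2) (N : ℕ) :
    ∑' k, gT x 0 k = gP (1-x) N ^ 2 / (gP 1 N * gP (1-2*x) N) * ∑' k, gT x N k := by
  obtain ⟨ha, hb⟩ := abs_lt.1 hx
  induction N with
  | zero => simp [gP]
  | succ N ih =>
    rw [ih, gP_succ, gP_succ, gP_succ]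
    have h := gF_rec hx N
    have h1 := gP_pos (x := 1 - 2*x) (by linarith) N
    have h2 := gP_pos (x := 1) (by linarith) N
    have h3 : (0:ℝ) < (N:ℝ) + 1 - 2*x := by have : (0:ℝ) ≤ N := by positivity
                                            linarith
    have h4 : ∑' k, gT x N k = ((N:ℝ)+1-x)^2/((N:ℝ)+1) * (∑' k, gT x (N+1) k) / ((N:ℝ) + 1 - 2*x) := by
      rw [← h]; field_simp
    rw [h4]
    have h5 : (1 - 2*x + N) ≠ 0 := by linarith
    have h6 : (1 - 2*x + N) = ((N:ℝ) + 1 - 2*x) := by ring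
    rw [h6]
    have h7 : (1 - x + N) = ((N:ℝ) + 1 - x) := by ring
    rw [h7, add_comm (1:ℝ) N]
    field_simp

lemma gF_tendsto {x : ℝ} (hx : |x| < 1/2) :
    Tendsto (fun N : ℕ => ∑' k, gT x N k) atTop (𝓝 1) := by
  have h0 : ∑' k : ℕ, (if k = 0 then (1:ℝ) else 0) = 1 := by simp
  rw [← h0]
  refine tendsto_tsum_of_dominated_convergence (summable_gE_sq hx) (fun k => ?_)
    (Eventually.of_forall fun N k => by
      rw [Real.norm_of_nonneg (gT_nonneg _ _ _)]; exact gT_le x N k)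
  rcases k with _ | k
  · simp [gT, gP]
  · simp only [Nat.add_eq_zero_iff, one_ne_zero, and_false, if_false]
    have hb : ∀ N : ℕ, gT x N (k+1) ≤ gP x (k+1)^2 * (1 / ((N:ℝ) + 1)) := by
      intro N
      unfold gT
      rw [mul_one_div]
      have h1 : (N:ℝ)+1 ≤ gP ((N:ℝ)+1) (k+1) := by
        clear * -
        induction k with
        | zero => simp [gP]
        | succ k ih =>
          rw [gP_succ]
          refine ih.trans (le_mul_of_one_le_right (gP_pos (by positivity) _).le ?_)
          have : (0:ℝ) ≤ N := by positivity
          push_cast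
          linarith [(by positivity : (0:ℝ) ≤ k)]
      have h2 : (1:ℝ) ≤ ((k+1)! : ℝ) := by exact_mod_cast Nat.one_le_iff_ne_zero.2 (Nat.factorial_ne_zero _)
      have h3 : (N:ℝ)+1 ≤ ((k+1)! : ℝ) * gP ((N:ℝ)+1) (k+1) :=
        h1.trans (le_mul_of_one_le_left (gP_pos (by positivity) _).le h2)
      gcongr
    refine squeeze_zero (fun N => gT_nonneg _ _ _) hb ?_
    simpa using (tendsto_one_div_add_atTop_nhds_zero_nat (𝕜 := ℝ)).const_mul (gP x (k+1)^2)

theorem tsum_gE_sq {x : ℝ} (hx : |x| < 1/2) :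
    ∑' k, gE x k ^ 2 = Real.Gamma (1 - 2 * x) / Real.Gamma (1 - x) ^ 2 := by
  obtain ⟨ha, hb⟩ := abs_lt.1 hx
  have h1 : Tendsto (fun n : ℕ => (Real.GammaSeq (1-2*x) n * Real.GammaSeq 1 n / Real.GammaSeq (1-x) n ^2)
      * ∑' k, gT x (n+1) k) atTop
      (𝓝 ((Real.Gamma (1-2*x) * Real.Gamma 1 / Real.Gamma (1-x)^2) * 1)) := by
    refine Tendsto.mul (Tendsto.div ((Real.GammaSeq_tendsto_Gamma _).mul
      (Real.GammaSeq_tendsto_Gamma _)) ((Real.GammaSeq_tendsto_Gamma _).pow 2) ?_)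
      ((tendsto_add_atTop_iff_nat 1).2 (gF_tendsto hx))
    have := Real.Gamma_pos_of_pos (s := 1 - x) (by linarith)
    positivity
  have h2 : (fun n : ℕ => (Real.GammaSeq (1-2*x) n * Real.GammaSeq 1 n / Real.GammaSeq (1-x) n ^2)
      * ∑' k, gT x (n+1) k) =ᶠ[atTop] fun _ => ∑' k, gT x 0 k := by
    filter_upwards [eventually_gt_atTop 0] with n hn
    have hn' : (0:ℝ) < n := by exact_mod_cast hn
    rw [gF_prod hx (n+1), gP_gammaSeq (by linarith) n hn, gP_gammaSeq (by linarith) n hn,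
      gP_gammaSeq (by linarith) n hn]
    congr 1
    have e : ((n:ℝ)^(1-x))^2 = (n:ℝ)^(1-2*x) * (n:ℝ)^(1:ℝ) := by
      rw [sq, ← Real.rpow_add hn', ← Real.rpow_add hn']; congr 1; ring
    have : (n ! : ℝ) ≠ 0 := by positivity
    have p1 : (n:ℝ)^(1-2*x) ≠ 0 := by positivity
    have p2 : (n:ℝ)^(1:ℝ) ≠ 0 := by positivity
    rw [div_pow, mul_pow, e, div_mul_div_comm, div_div_div_eq]
    field_simp
  have h3 := tendsto_nhds_unique (h1.congr' h2) tendsto_const_nhds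
  simp only [gT_zero] at h3
  rw [← h3]
  simp

open scoped NNReal ENNReal

noncomputable def lS : PowerSeries ℝ≥0 := PowerSeries.mk fun n => (n : ℝ≥0)⁻¹

noncomputable def lA (m k : ℕ) : ℝ≥0 := PowerSeries.coeff k (lS ^ m)

noncomputable def lR : PowerSeries ℝ := PowerSeries.mk fun n => (n : ℝ)⁻¹

lemma lS_map : PowerSeries.map NNReal.toRealHom lS = lR := by
  ext n
  simp [lS, lR]

lemma lA_coe (m k : ℕ) : ((lA m k : ℝ≥0) : ℝ) = PowerSeries.coeff k (lR ^ m) := by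
  rw [← lS_map, ← map_pow, PowerSeries.coeff_map]; rfl

open PowerSeries in
lemma lR_deriv (m : ℕ) : (d⁄dX ℝ (lR ^ (m+1))) * (1 - X) = ((m+1 : ℕ) : PowerSeries ℝ) * lR ^ m := by
  have h : d⁄dX ℝ lR = mk 1 := by
    ext n
    rw [coeff_derivative]
    simp only [lR, coeff_mk, Pi.one_apply]
    push_cast
    field_simp
  rw [Derivation.leibniz_pow, h]
  simp only [nsmul_eq_mul, smul_eq_mul, Nat.add_sub_cancel]
  rw [mul_assoc, mul_assoc, mk_one_mul_one_sub_eq_one, mul_one]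

open PowerSeries in
lemma lA_rec (m k : ℕ) : ((k:ℝ)+1) * lA (m+1) (k+1) = k * lA (m+1) k + (m+1) * lA m k := by
  have h := congrArg (coeff k) (lR_deriv m)
  rw [mul_sub, mul_one, map_sub, coeff_derivative, ← lA_coe] at h
  rw [← map_natCast (C (R := ℝ)), coeff_C_mul, ← lA_coe] at h
  rcases k with _ | k
  · simp at h ⊢
    linarith
  · rw [coeff_succ_mul_X, coeff_derivative, ← lA_coe] at h
    push_cast at h ⊢
    linarith

lemma lA_zero (k : ℕ) : lA 0 k = if k = 0 then 1 else 0 := by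
  simp [lA, PowerSeries.coeff_one]

lemma lA_zero_right (m : ℕ) : lA m 0 = if m = 0 then 1 else 0 := by
  rcases m with _ | m <;> simp [lA, lS]

lemma hasSum_lA (x : ℝ) (k : ℕ) : HasSum (fun m : ℕ => (lA m k : ℝ) * (x ^ m / m !)) (gE x k) := by
  induction k with
  | zero =>
    have : (fun m : ℕ => (lA m 0 : ℝ) * (x ^ m / m !)) = fun m => if m = 0 then 1 else 0 := by
      ext m
      rw [lA_zero_right]
      split_ifs with h <;> simp [h]
    rw [this]
    simpa [gE, gP] using hasSum_ite_eq (0:ℕ) (1:ℝ)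
  | succ k ih =>
    rw [← hasSum_nat_add_iff' 1]
    have h1 := ((hasSum_nat_add_iff' 1).2 ih).mul_left (k:ℝ)
    have h2 := (h1.add (ih.mul_left x)).mul_left (((k:ℝ)+1)⁻¹)
    have hk : (k:ℝ)+1 ≠ 0 := by positivity
    convert! h2 using 1
    · ext m
      have := lA_rec m k
      have h3 : (lA (m+1) (k+1) : ℝ) = ((k:ℝ)+1)⁻¹ * (k * lA (m+1) k + (m+1) * lA m k) := by
        rw [← this]; field_simp
      rw [h3, Nat.factorial_succ, pow_succ]
      have : (m ! : ℝ) ≠ 0 := by positivity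
      push_cast
      field_simp
    · have := gE_succ x k
      have h3 : gE x (k+1) = ((k:ℝ)+1)⁻¹ * ((k + x) * gE x k) := by rw [← this]; field_simp
      rw [h3]
      rcases k with _ | k
      · simp [lA_zero]
      · simp only [lA_zero, Finset.sum_range_one]; simp; left; ring

/-- the shift operator attached to a power series -/
noncomputable def shOp (e : ℤ) (F : PowerSeries ℝ≥0) : Module.End ℝ≥0∞ (ℤ → ℝ≥0∞) where
  toFun f₁ k := ∑' p : ℕ, ((PowerSeries.coeff p F : ℝ≥0) : ℝ≥0∞) * f₁ (k + e * p)
  map_add' f₁ f₂ := by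
    ext k
    simp [mul_add, ENNReal.tsum_add]
  map_smul' c f₁ := by
    ext k
    simp only [Pi.smul_apply, smul_eq_mul, RingHom.id_apply]
    rw [← ENNReal.tsum_mul_left]
    exact tsum_congr fun p => by ring

lemma shOp_apply (e : ℤ) (F : PowerSeries ℝ≥0) (f₁ : ℤ → ℝ≥0∞) (k : ℤ) :
    shOp e F f₁ k = ∑' p : ℕ, ((PowerSeries.coeff p F : ℝ≥0) : ℝ≥0∞) * f₁ (k + e * p) := rfl

lemma shOp_comm (e e' : ℤ) (F G : PowerSeries ℝ≥0) : Commute (shOp e F) (shOp e' G) := by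
  refine LinearMap.ext fun f₁ => funext fun k => ?_
  simp only [Module.End.mul_apply, shOp_apply, ← ENNReal.tsum_mul_left]
  rw [ENNReal.tsum_comm]
  refine tsum_congr fun p => tsum_congr fun q => ?_
  rw [mul_left_comm, add_right_comm]

lemma tsum_antidiag (f : ℕ → ℕ → ℝ≥0∞) :
    ∑' n, ∑ p ∈ Finset.HasAntidiagonal.antidiagonal n, f p.1 p.2 = ∑' p, ∑' q, f p q := by
  rw [← ENNReal.tsum_prod (f := f)]
  rw [← Finset.HasAntidiagonal.sigmaAntidiagonalEquivProd.tsum_eq, ENNReal.tsum_sigma']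
  refine tsum_congr fun n => ?_
  rw [tsum_fintype]
  simp only [Finset.HasAntidiagonal.sigmaAntidiagonalEquivProd_apply]
  exact (Finset.sum_coe_sort (Finset.HasAntidiagonal.antidiagonal n) (fun p => f p.1 p.2)).symm

lemma shOp_mul (e : ℤ) (F G : PowerSeries ℝ≥0) : shOp e (F * G) = shOp e F * shOp e G := by
  refine LinearMap.ext fun f₁ => funext fun k => ?_
  simp only [Module.End.mul_apply, shOp_apply, ← ENNReal.tsum_mul_left]
  rw [← tsum_antidiag (fun p q => ((PowerSeries.coeff p F : ℝ≥0) : ℝ≥0∞) *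
    (((PowerSeries.coeff q G : ℝ≥0) : ℝ≥0∞) * f₁ (k + e * p + e * q)))]
  refine tsum_congr fun n => ?_
  rw [PowerSeries.coeff_mul]
  push_cast
  rw [Finset.sum_mul]
  refine Finset.sum_congr rfl fun p hp => ?_
  rw [← Finset.HasAntidiagonal.mem_antidiagonal.1 hp, mul_assoc]
  push_cast
  rw [mul_add, add_assoc]

lemma shOp_one (e : ℤ) : shOp e 1 = 1 := by
  refine LinearMap.ext fun f₁ => funext fun k => ?_
  rw [shOp_apply, tsum_eq_single 0]
  · simp
  · intro b hb; simp [PowerSeries.coeff_one, hb]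

lemma shOp_pow (e : ℤ) (F : PowerSeries ℝ≥0) (n : ℕ) : shOp e F ^ n = shOp e (F ^ n) := by
  induction n with
  | zero => simp [shOp_one]
  | succ n ih => rw [pow_succ, pow_succ, ih, shOp_mul]

noncomputable def wt (a : ℤ) : ℝ≥0 := (a.natAbs : ℝ≥0)⁻¹

noncomputable def del (a : ℤ) : ℝ≥0∞ := if a = 0 then 1 else 0

lemma shOp_add (f₁ : ℤ → ℝ≥0∞) (k : ℤ) :
    (shOp 1 lS + shOp (-1) lS) f₁ k = ∑' a : ℤ, (wt a : ℝ≥0∞) * f₁ (k + a) := by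
  rw [LinearMap.add_apply, Pi.add_apply, shOp_apply, shOp_apply,
    ← Equiv.intEquivNatSumNat.symm.tsum_eq, Summable.tsum_sum ENNReal.summable ENNReal.summable]
  congr 1
  · refine tsum_congr fun p => ?_
    simp [Equiv.intEquivNatSumNat, wt, lS]
  · rw [tsum_eq_zero_add' ENNReal.summable]
    have h0 : (PowerSeries.coeff 0 lS : ℝ≥0) = 0 := by simp [lS]
    rw [h0, ENNReal.coe_zero, zero_mul, zero_add]
    refine tsum_congr fun p => ?_
    have h1 : (Equiv.intEquivNatSumNat.symm (Sum.inr p) : ℤ) = -1 * ((p+1 : ℕ) : ℤ) := by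
      simp [Equiv.intEquivNatSumNat, Int.negSucc_eq]
    have h2 : (-1 * ((p+1 : ℕ) : ℤ)).natAbs = p + 1 := by omega
    rw [h1, wt, h2, lS, PowerSeries.coeff_mk]

lemma shOp_add_pow (n : ℕ) (f₁ : ℤ → ℝ≥0∞) (k : ℤ) :
    ((shOp 1 lS + shOp (-1) lS) ^ n) f₁ k =
      ∑' a : Fin n → ℤ, ((∏ i, wt (a i) : ℝ≥0) : ℝ≥0∞) * f₁ (k + ∑ i, a i) := by
  induction n generalizing k with
  | zero => 
    simp
  | succ n ih =>
    rw [pow_succ', Module.End.mul_apply, shOp_add]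
    rw [← (Fin.consEquiv (fun _ => ℤ)).tsum_eq, ENNReal.tsum_prod']
    refine tsum_congr fun a => ?_
    rw [ih, ← ENNReal.tsum_mul_left]
    refine tsum_congr fun b => ?_
    simp [Fin.consEquiv, Fin.prod_univ_succ, Fin.sum_univ_succ, mul_assoc, add_assoc]

lemma shOp_mul_del (m l : ℕ) :
    (shOp 1 lS ^ m * shOp (-1) lS ^ l) del 0 = ∑' k, ((lA m k * lA l k : ℝ≥0) : ℝ≥0∞) := by
  rw [shOp_pow, shOp_pow, Module.End.mul_apply, shOp_apply]
  refine tsum_congr fun p => ?_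
  rw [shOp_apply, tsum_eq_single p]
  · simp [del, lA]
  · intro q hq
    have : (0 + 1 * (p:ℤ) + -1 * (q:ℤ)) ≠ 0 := by omega
    simp only [del, if_neg this, mul_zero]

lemma symMT_ennreal (n : ℕ) :
    ∑' a : Fin n → ℤ, ((∏ i, wt (a i) : ℝ≥0) : ℝ≥0∞) * del (∑ i, a i) =
     ∑ p ∈ Finset.HasAntidiagonal.antidiagonal n, (n.choose p.1 : ℝ≥0∞) * ∑' k, ((lA p.1 k * lA p.2 k : ℝ≥0) : ℝ≥0∞) := by
  have h := shOp_add_pow n del 0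
  simp only [zero_add] at h
  rw [← h, (shOp_comm 1 (-1) lS lS).add_pow']
  rw [LinearMap.sum_apply, Finset.sum_apply]
  refine Finset.sum_congr rfl fun p _ => ?_
  rw [← shOp_mul_del]
  simp

lemma symMT_eq_toReal (n : ℕ) : symMT n (fun _ => 1) =
    (∑' a : Fin n → ℤ, ((∏ i, wt (a i) : ℝ≥0) : ℝ≥0∞) * del (∑ i, a i)).toReal := by
  unfold symMT
  have h1 : ∑' a : Fin n → ℤ, ((∏ i, wt (a i) : ℝ≥0) : ℝ≥0∞) * del (∑ i, a i) =
    ∑' a : {a : Fin n → ℤ // (∀ i, a i ≠ 0) ∧ ∑ i, a i = 0}, ((∏ i, wt (a.1 i) : ℝ≥0) : ℝ≥0∞) := by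
    refine Eq.trans ?_ (tsum_subtype {a : Fin n → ℤ | (∀ i, a i ≠ 0) ∧ ∑ i, a i = 0} (fun a => ((∏ i, wt (a i) : ℝ≥0) : ℝ≥0∞))).symm
    refine tsum_congr fun a => ?_
    by_cases hs : ∑ i, a i = 0
    · by_cases hz : ∀ i, a i ≠ 0
      · rw [Set.indicator_of_mem (show a ∈ {a : Fin n → ℤ | (∀ i, a i ≠ 0) ∧ ∑ i, a i = 0} from ⟨hz, hs⟩)]
        simp [del, hs]
      · rw [Set.indicator_of_notMem (fun h => hz h.1)]
        push Not at hz
        obtain ⟨i, hi⟩ := hz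
        rw [Finset.prod_eq_zero (Finset.mem_univ i) (by simp [wt, hi])]
        simp
    · rw [Set.indicator_of_notMem (fun h => hs h.2)]
      simp [del, hs]
  rw [h1, ENNReal.tsum_toReal_eq (fun _ => ENNReal.coe_ne_top)]
  refine tsum_congr fun a => ?_
  simp [wt, Finset.abs_prod, Nat.cast_natAbs]

noncomputable def gg (x : ℝ) (q : ℕ × (ℕ × ℕ)) : ℝ :=
  ((lA q.2.1 q.1 : ℝ) * (x ^ q.2.1 / q.2.1 !)) * ((lA q.2.2 q.1 : ℝ) * (x ^ q.2.2 / q.2.2 !))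

lemma gg_fiber_summable_nonneg {x : ℝ} (hx : 0 ≤ x) (k : ℕ) : Summable (fun p : ℕ × ℕ => gg x (k, p)) := 
  (hasSum_lA x k).summable.mul_of_nonneg (hasSum_lA x k).summable
    (fun _ => by positivity) (fun _ => by positivity)

lemma gg_norm (x : ℝ) (q) : ‖gg x q‖ = gg |x| q := by
  simp [gg]

lemma gg_fiber (x : ℝ) (k : ℕ) : HasSum (fun p : ℕ × ℕ => gg x (k, p)) (gE x k ^ 2) := by
  rw [sq]
  refine (hasSum_lA x k).mul (hasSum_lA x k) ?_
  refine Summable.of_norm ?_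
  change Summable (fun p : ℕ × ℕ => ‖gg x (k, p)‖)
  simp only [gg_norm]
  exact gg_fiber_summable_nonneg (abs_nonneg x) k

lemma gg_summable {x : ℝ} (hx : |x| < 1/2) : Summable (gg x) := by
  refine Summable.of_norm ?_
  simp only [gg_norm]
  rw [summable_prod_of_nonneg (fun q => by unfold gg; dsimp; positivity)]
  refine ⟨fun k => (gg_fiber _ k).summable, ?_⟩
  simp only [(gg_fiber _ _).tsum_eq]
  exact summable_gE_sq (by rwa [abs_abs])

lemma gg_hasSum {x : ℝ} (hx : |x| < 1/2) : HasSum (gg x) (∑' k, gE x k ^ 2) := by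
  have h := (gg_summable hx).hasSum
  rw [(h.prod_fiberwise (gg_fiber x)).tsum_eq]
  exact h

lemma lA_summable (m l : ℕ) : Summable (fun k => lA m k * lA l k) := by
  have h := (gg_summable (x := 1/4) (by rw [abs_of_pos] <;> norm_num)).prod_symm.prod_factor (m, l)
  rw [← NNReal.summable_coe]
  have h2 := h.mul_left ((((1/4:ℝ)^m/m !) * ((1/4:ℝ)^l/l !))⁻¹)
  refine h2.congr fun k => ?_
  have : (m ! : ℝ) ≠ 0 := by positivity
  have : (l ! : ℝ) ≠ 0 := by positivity
  simp only [gg, Prod.swap]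
  push_cast
  field_simp

lemma symMT_eq (n : ℕ) : symMT n (fun _ => 1) =
    ∑ p ∈ Finset.HasAntidiagonal.antidiagonal n, (n.choose p.1 : ℝ) * ∑' k, ((lA p.1 k : ℝ) * lA p.2 k) := by
  rw [symMT_eq_toReal, symMT_ennreal, ENNReal.toReal_sum]
  · refine Finset.sum_congr rfl fun p _ => ?_
    rw [ENNReal.toReal_mul, ENNReal.tsum_toReal_eq (fun _ => ENNReal.coe_ne_top)]
    simp
  · intro p _
    exact ENNReal.mul_ne_top (by simp) (ENNReal.tsum_coe_ne_top_iff_summable.2 (lA_summable _ _))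

/-- For every real `x` with `|x| < 1/2`, the exponential generating function of the
values `ζ̄_n = ζ̄_n(1,…,1)` (with `ζ̄_0 = 1`) satisfies
`Σ_{n=0}^∞ ζ̄_n xⁿ/n! = Γ(1−2x)/Γ(1−x)²`. -/
theorem hasSum_symMT_egf (x : ℝ) (hx : |x| < 1 / 2) :
    HasSum (fun n : ℕ => (if n = 0 then 1 else symMT n (fun _ => 1)) * x ^ n / (n ! : ℝ))
      (Real.Gamma (1 - 2 * x) / Real.Gamma (1 - x) ^ 2) := by
  rw [← tsum_gE_sq hx]
  have h1 : HasSum (fun q : (ℕ × ℕ) × ℕ => gg x q.swap) (∑' k, gE x k ^ 2) :=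
    (Equiv.prodComm _ _).hasSum_iff.2 (gg_hasSum hx)
  have h2 := h1.prod_fiberwise (fun p => (h1.summable.prod_factor p).hasSum)
  have h3 := (Finset.HasAntidiagonal.sigmaAntidiagonalEquivProd (A := ℕ)).hasSum_iff.2 h2
  have h4 := h3.sigma (fun n => hasSum_fintype _)
  convert! h4 using 1
  ext n
  have h5 : (if n = 0 then 1 else symMT n (fun _ => 1)) = symMT n (fun _ => 1) := by
    split_ifs with h
    · subst h
      rw [symMT_eq]
      simp only [Finset.HasAntidiagonal.antidiagonal_zero, Finset.sum_singleton, lA_zero]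
      rw [tsum_eq_single 0 (fun k hk => by simp [hk])]
      simp
    · rfl
  rw [h5, symMT_eq]
  simp only [Function.comp, Finset.HasAntidiagonal.sigmaAntidiagonalEquivProd_apply]
  rw [Finset.sum_coe_sort (Finset.HasAntidiagonal.antidiagonal n) (fun p => ∑' k, gg x (p, k).swap),
    mul_div_assoc, Finset.sum_mul]
  refine Finset.sum_congr rfl fun p hp => ?_
  rw [Finset.HasAntidiagonal.mem_antidiagonal] at hp
  rw [mul_right_comm, ← tsum_mul_left]
  refine tsum_congr fun k => ?_
  subst hp
  rw [Nat.choose_symm_add, Nat.add_choose,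
    Nat.cast_div (Nat.factorial_mul_factorial_dvd_factorial_add _ _) (by positivity)]
  have e1 : ((p.1 + p.2)! : ℝ) ≠ 0 := by positivity
  have e2 : (p.1 ! : ℝ) ≠ 0 := by positivity
  have e3 : (p.2 ! : ℝ) ≠ 0 := by positivity
  simp only [gg, Prod.swap]
  push_cast
  field_simp
  try ring
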